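/- arXiv:hep-th/9509094 — 2 statements merged into one kernel-verified Lean document; each statement's English description precedes it below -/
import Mathlib

section
/- For every smooth function g(t,q₀,…,q_{2k−2},p⁰), the identity K₀·g = ⟨[L], (∂g/∂p⁰)∘F₀⟩ + D_t(g∘F₀) holds identically as functions of (t,q₀,…,q_{2k}), where the left-hand side does not depend on q_{2k} (the paper's relation (8) connecting the intermediate evolution operator K₀ with the Euler–Lagrange expression). -/
open scoped BigOperators

noncomputable section

/-- `Vec n` is `ℝⁿ`. -/
abbrev Vec (n : ℕ) := Fin n → ℝ

/-- `Jet n m` packages the variables `q₀, …, q_m`, each a vector of `ℝⁿ`. -/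
abbrev Jet (n m : ℕ) := Fin (m+1) → Vec n

/-- The standard inner product on `ℝⁿ`. -/
def dot {n : ℕ} (u v : Vec n) : ℝ := ∑ a, u a * v a

/-- Forget the top variable `q_{m+1}`. -/
def res {n m : ℕ} (q : Jet n (m+1)) : Jet n m := fun i => q i.castSucc

/-- The shift `(shft q) i = q (i+1)`. -/
def shft {n m : ℕ} (q : Jet n (m+1)) : Jet n m := fun i => q i.succ

/-- Restriction of a jet to a lower-order jet. -/
def trunc {n m m' : ℕ} (h : m' ≤ m) (q : Jet n m) : Jet n m' :=
  fun i => q (Fin.castLE (Nat.succ_le_succ h) i)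

/-- The partial gradient of `f` in the slot `q_i`, identified with a vector of `ℝⁿ`
via the standard inner product (i.e. the vector representing the partial
differential `∂f/∂q_i`). -/
def gradSlot {n m : ℕ} (f : Jet n m → ℝ) (q : Jet n m) (i : Fin (m+1)) : Vec n :=
  fun a => fderiv ℝ f q (Pi.single i (Pi.single a 1))

/-- The formal total time derivative of a time-independent function
`f(q₀,…,q_m)`: `D_t f = Σ_i (∂f/∂q_i)·q_{i+1}`, a function of `(q₀,…,q_{m+1})`. -/
def Dt0 {n m : ℕ} {F : Type*} [NormedAddCommGroup F] [NormedSpace ℝ F]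
    (f : Jet n m → F) (q : Jet n (m+1)) : F :=
  fderiv ℝ f (res q) (shft q)

/-- Iterated formal total time derivative (time-independent functions). -/
def DtIter0 {n m : ℕ} {F : Type*} [NormedAddCommGroup F] [NormedSpace ℝ F] :
    (r : ℕ) → (Jet n m → F) → (Jet n (m + r) → F)
  | 0, f => f
  | r+1, f => Dt0 (DtIter0 r f)

/-- The formal total time derivative of a time-dependent function
`f(t,q₀,…,q_m)`: `D_t f = ∂f/∂t + Σ_i (∂f/∂q_i)·q_{i+1}`. -/
def Dt {n m : ℕ} {F : Type*} [NormedAddCommGroup F] [NormedSpace ℝ F]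
    (f : ℝ × Jet n m → F) (x : ℝ × Jet n (m+1)) : F :=
  fderiv ℝ f (x.1, res x.2) (1, shft x.2)

/-- Iterated formal total time derivative (time-dependent functions). -/
def DtIter {n m : ℕ} {F : Type*} [NormedAddCommGroup F] [NormedSpace ℝ F] :
    (r : ℕ) → (ℝ × Jet n m → F) → (ℝ × Jet n (m + r) → F)
  | 0, f => f
  | r+1, f => Dt (DtIter r f)

/-- The partial gradient in the slot `q_i` of a time-dependent function. -/
def gradSlotT {n m : ℕ} (f : ℝ × Jet n m → ℝ) (x : ℝ × Jet n m) (i : Fin (m+1)) : Vec n :=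
  fun a => fderiv ℝ f x (0, Pi.single i (Pi.single a 1))

/-- The Ostrogradskii momenta of a Lagrangian `L(q₀,…,q_{k+1})` of order `k+1`:
`mom L j` is the momentum `p̂^{k-j}`, a function of `(q₀,…,q_{k+j+1})`.
It is defined by the downward recursion `p̂^{k} = ∂L/∂q_{k+1}` and
`p̂^{i-1} = ∂L/∂q_i − D_t p̂^i`. -/
def mom {n k : ℕ} (L : Jet n (k+1) → ℝ) : (j : ℕ) → (Jet n (k + j + 1) → Vec n)
  | 0 => fun q => gradSlot L q (Fin.last (k+1))
  | j+1 => fun q =>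
      gradSlot L (trunc (by omega) q) ⟨k - j, by omega⟩ - Dt0 (mom L j) q

/-- The Euler–Lagrange expression `[L] = Σ_{r=0}^{k+1} (−1)^r D_t^r (∂L/∂q_r)`
of a Lagrangian of order `k+1`, a function of `(q₀,…,q_{2(k+1)})`. -/
def EL {n k : ℕ} (L : Jet n (k+1) → ℝ) (q : Jet n (k+k+2)) : Vec n :=
  ∑ r : Fin (k+2),
    ((-1 : ℝ)) ^ (r : ℕ) •
      DtIter0 (r : ℕ) (fun q' => gradSlot L q' r)
        (trunc (by have := r.isLt; omega) q)

/-- The Hessian `W = ∂²L/∂q_{k+1}∂q_{k+1}` of a Lagrangian of order `k+1`,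
as an operator `ℝⁿ → ℝⁿ` (a function of `(q₀,…,q_{k+1})`). -/
def hessOp {n k : ℕ} (L : Jet n (k+1) → ℝ) (q : Jet n (k+1)) (v : Vec n) : Vec n :=
  fun a => fderiv ℝ (fun q' => gradSlot L q' (Fin.last (k+1)) a) q
    (Pi.single (Fin.last (k+1)) v)

/-- The first partial Legendre–Ostrogradskii transformation
`F₀ : (q₀,…,q_{2k+1}) ↦ (q₀,…,q_{2k}; p̂⁰)`. -/
def F0 {n k : ℕ} (L : Jet n (k+1) → ℝ) (q : Jet n (k+k+1)) : Jet n (k+k) × Vec n :=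
  (res q, mom L k q)

/-- Pull-back through `F₀` of a (time-dependent) function on the intermediate
space `P₁`. -/
def pullF0 {n k : ℕ} {F : Type*} (L : Jet n (k+1) → ℝ)
    (g : ℝ × (Jet n (k+k) × Vec n) → F) (x : ℝ × Jet n (k+k+1)) : F :=
  g (x.1, F0 L x.2)

/-- The intermediate evolution operator `K₀`:
`K₀·g = (∂g/∂t)∘F₀ + Σ_{i=0}^{2k} ((∂g/∂q_i)∘F₀)·q_{i+1} + ((∂g/∂p⁰)∘F₀)·(∂L/∂q₀)`. -/
def K0 {n k : ℕ} {F : Type*} [NormedAddCommGroup F] [NormedSpace ℝ F]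
    (L : Jet n (k+1) → ℝ)
    (g : ℝ × (Jet n (k+k) × Vec n) → F) (x : ℝ × Jet n (k+k+1)) : F :=
  fderiv ℝ g (x.1, F0 L x.2)
    (1, shft x.2, gradSlot L (trunc (by omega) x.2) 0)

/-- The partial gradient `∂g/∂p⁰` of a function on `P₁`, as a vector of `ℝⁿ`. -/
def gradMom {n k : ℕ} (g : ℝ × (Jet n (k+k) × Vec n) → ℝ)
    (x : ℝ × (Jet n (k+k) × Vec n)) : Vec n :=
  fun a => fderiv ℝ g x (0, 0, Pi.single a 1)

/-- Truncation of jets as a continuous linear map. -/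
def truncL {n m m' : ℕ} (h : m' ≤ m) : Jet n m →L[ℝ] Jet n m' :=
  ContinuousLinearMap.pi fun i => ContinuousLinearMap.proj (Fin.castLE (Nat.succ_le_succ h) i)

/-- The shift of jets as a continuous linear map. -/
def shftL {n m : ℕ} : Jet n (m+1) →L[ℝ] Jet n m :=
  ContinuousLinearMap.pi fun i => ContinuousLinearMap.proj i.succ

theorem contDiff_trunc {n m m' : ℕ} (h : m' ≤ m) :
    ContDiff ℝ (⊤ : ℕ∞) (trunc h : Jet n m → Jet n m') := (truncL h).contDiff

section TotalDerivative

variable {n m : ℕ} {F : Type*} [NormedAddCommGroup F] [NormedSpace ℝ F]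

theorem contDiff_Dt0 {f : Jet n m → F} (hf : ContDiff ℝ (⊤ : ℕ∞) f) :
    ContDiff ℝ (⊤ : ℕ∞) (Dt0 f) :=
  ((hf.fderiv_right (m := (⊤ : ℕ∞)) le_rfl).comp (truncL m.le_succ).contDiff).clm_apply
    shftL.contDiff

theorem contDiff_DtIter0 {f : Jet n m → F} (hf : ContDiff ℝ (⊤ : ℕ∞) f) (r : ℕ) :
    ContDiff ℝ (⊤ : ℕ∞) (DtIter0 r f) := by
  induction r with
  | zero => exact hf
  | succ r ih => exact contDiff_Dt0 ih

/-- The total derivative commutes with truncation. -/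
theorem Dt0_comp_trunc {m' : ℕ} (h : m' ≤ m) {f : Jet n m' → F} (hf : Differentiable ℝ f)
    (q : Jet n (m+1)) :
    Dt0 (fun q' => f (trunc h q')) q = Dt0 f (trunc (Nat.succ_le_succ h) q) := by
  have key := ((hf (trunc h (res q))).hasFDerivAt.comp (res q) (truncL h).hasFDerivAt).fderiv
  exact congrArg (fun T : Jet n m →L[ℝ] F => T (shft q)) key

theorem Dt0_sum_smul {ι : Type*} (s : Finset ι) (c : ι → ℝ) {f : ι → Jet n m → F}
    (hf : ∀ i ∈ s, Differentiable ℝ (f i)) (q : Jet n (m+1)) :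
    Dt0 (fun q' => ∑ i ∈ s, c i • f i q') q = ∑ i ∈ s, c i • Dt0 (f i) q := by
  have key := (HasFDerivAt.fun_sum fun i hi =>
    ((hf i hi (res q)).hasFDerivAt.const_smul (c i))).fderiv
  simp only [Dt0]
  refine (congrArg (fun T : Jet n m →L[ℝ] F => T (shft q)) key).trans ?_
  simp

end TotalDerivative

/-- The partial gradient `∂f/∂q_i`, for an index `i : ℕ`, set to zero beyond the order of `f`. -/
def gradAt {n m : ℕ} (f : Jet n m → ℝ) (i : ℕ) (q : Jet n m) : Vec n :=
  if h : i < m + 1 then gradSlot f q ⟨i, h⟩ else 0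

theorem gradAt_coe {n m : ℕ} (f : Jet n m → ℝ) (i : Fin (m+1)) :
    gradAt f i = fun q => gradSlot f q i := by
  funext q
  simp [gradAt, i.isLt]

theorem contDiff_gradAt {n m : ℕ} {f : Jet n m → ℝ} (hf : ContDiff ℝ (⊤ : ℕ∞) f) (i : ℕ) :
    ContDiff ℝ (⊤ : ℕ∞) (gradAt f i) := by
  by_cases h : i < m + 1
  · rw [show gradAt f i = fun q => gradSlot f q ⟨i, h⟩ from gradAt_coe f ⟨i, h⟩]
    exact contDiff_pi.2 fun a =>
      (hf.fderiv_right (m := (⊤ : ℕ∞)) le_rfl).clm_apply contDiff_const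
  · rw [show gradAt f i = fun _ => 0 from funext fun q => dif_neg h]
    exact contDiff_const

/-- Subtracting `D_t` of an alternating sum of iterated derivatives shifts the sum by one. -/
theorem gradAt_sub_Dt0_alternating_sum {n k : ℕ} {L : Jet n (k+1) → ℝ}
    (hL : ContDiff ℝ (⊤ : ℕ∞) L) (i j : ℕ) (q : Jet n (k + j + 2)) :
    gradAt L i (trunc (by omega) q) -
        Dt0 (fun q' : Jet n (k + j + 1) => ∑ s : Fin (j+1), (-1 : ℝ) ^ (s : ℕ) •
          DtIter0 (s : ℕ) (gradAt L (i + 1 + s)) (trunc (by have := s.isLt; omega) q')) q =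
      ∑ s : Fin (j+2), (-1 : ℝ) ^ (s : ℕ) •
        DtIter0 (s : ℕ) (gradAt L (i + s)) (trunc (by have := s.isLt; omega) q) := by
  have hdiff (s : Fin (j+1)) :
      Differentiable ℝ (DtIter0 (s : ℕ) (gradAt L (i + 1 + s))) :=
    (contDiff_DtIter0 (contDiff_gradAt hL _) _).differentiable (by simp)
  have hle (s : Fin (j+1)) : k + 1 + (s : ℕ) ≤ k + j + 1 := by have := s.isLt; omega
  rw [Dt0_sum_smul Finset.univ _ (f := fun s : Fin (j+1) => fun q' : Jet n (k + j + 1) =>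
      DtIter0 (s : ℕ) (gradAt L (i + 1 + s)) (trunc (hle s) q'))
    fun s _ => (hdiff s).comp (truncL (hle s)).differentiable]
  rw [Fin.sum_univ_succ (n := j + 1), sub_eq_add_neg, ← Finset.sum_neg_distrib]
  congr 1
  · simp [DtIter0]
  · refine Finset.sum_congr rfl fun s _ => ?_
    rw [Dt0_comp_trunc (hle s) (hdiff s)]
    have hidx : i + ((s.succ : Fin (j+2)) : ℕ) = i + 1 + s := by simp; omega
    have hsign : (-1 : ℝ) ^ ((s.succ : Fin (j+2)) : ℕ) = -(-1) ^ (s : ℕ) := by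
      simp [pow_succ]
    rw [hidx, hsign, neg_smul]
    rfl

/-- Closed form of the Ostrogradskii momenta. -/
theorem mom_eq_alternating_sum {n k : ℕ} {L : Jet n (k+1) → ℝ}
    (hL : ContDiff ℝ (⊤ : ℕ∞) L) (j : ℕ) (hj : j ≤ k) :
    mom L j = fun q => ∑ s : Fin (j+1), (-1 : ℝ) ^ (s : ℕ) •
      DtIter0 (s : ℕ) (gradAt L (k - j + 1 + s)) (trunc (by have := s.isLt; omega) q) := by
  induction j with
  | zero =>
    funext q
    simp [mom, DtIter0, gradAt, Fin.last]
    rfl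
  | succ j ih =>
    funext q
    have hidx : k - (j + 1) + 1 = k - j := by omega
    rw [hidx, ← gradAt_sub_Dt0_alternating_sum hL, ← ih (by omega)]
    rw [show gradAt L (k - j) = _ from gradAt_coe L ⟨k - j, by omega⟩]
    rfl

theorem contDiff_mom {n k : ℕ} {L : Jet n (k+1) → ℝ} (hL : ContDiff ℝ (⊤ : ℕ∞) L)
    (j : ℕ) (hj : j ≤ k) : ContDiff ℝ (⊤ : ℕ∞) (mom L j) := by
  rw [mom_eq_alternating_sum hL j hj]
  exact ContDiff.sum fun s _ => ContDiff.const_smul _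
    ((contDiff_DtIter0 (contDiff_gradAt hL _) _).comp (contDiff_trunc _))

/-- The Euler–Lagrange expression is `∂L/∂q₀ − D_t p̂⁰`. -/
theorem EL_eq_gradSlot_sub_Dt0_mom {n k : ℕ} {L : Jet n (k+1) → ℝ}
    (hL : ContDiff ℝ (⊤ : ℕ∞) L) (q : Jet n (k+k+2)) :
    EL L q = gradSlot L (trunc (by omega) q) 0 - Dt0 (mom L k) q := by
  have h := gradAt_sub_Dt0_alternating_sum hL 0 k q
  have hm := mom_eq_alternating_sum hL k le_rfl
  simp only [Nat.sub_self] at hm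
  rw [← hm, show gradAt L 0 = _ from gradAt_coe L 0] at h
  rw [h, EL]
  refine Finset.sum_congr rfl fun s _ => ?_
  rw [Nat.zero_add, gradAt_coe]

/-- The pairing of a vector with `∂g/∂p⁰` is the derivative of `g` along that vector. -/
theorem dot_gradMom {n k : ℕ} (g : ℝ × (Jet n (k+k) × Vec n) → ℝ)
    (x : ℝ × (Jet n (k+k) × Vec n)) (v : Vec n) :
    dot v (gradMom g x) = fderiv ℝ g x (0, 0, v) := by
  let T : Vec n →L[ℝ] ℝ := (fderiv ℝ g x).comp
    ((ContinuousLinearMap.inr ℝ ℝ (Jet n (k+k) × Vec n)).comp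
      (ContinuousLinearMap.inr ℝ (Jet n (k+k)) (Vec n)))
  have h : T v = ∑ a, v a • T (Pi.single a 1) := by
    conv_lhs => rw [pi_eq_sum_univ' v]
    simp [map_sum, map_smul]
  exact h.symm

/-- Chain rule for the total derivative of a pull-back through `F₀`. -/
theorem Dt_pullF0 {n k : ℕ} {L : Jet n (k+1) → ℝ} (hL : ContDiff ℝ (⊤ : ℕ∞) L)
    {g : ℝ × (Jet n (k+k) × Vec n) → ℝ} (hg : Differentiable ℝ g) (t : ℝ) (q : Jet n (k+k+2)) :
    Dt (pullF0 L g) (t, q) =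
      fderiv ℝ g (t, F0 L (res q)) (1, shft (res q), Dt0 (mom L k) q) := by
  have hmom : HasFDerivAt (mom L k) (fderiv ℝ (mom L k) (res q)) (res q) :=
    ((contDiff_mom hL k le_rfl).differentiable (by simp) _).hasFDerivAt
  have hF0 : HasFDerivAt (F0 L)
      ((truncL (k+k).le_succ).prod (fderiv ℝ (mom L k) (res q))) (res q) :=
    (truncL (k+k).le_succ).hasFDerivAt.prodMk hmom
  have hpull := (hg (t, F0 L (res q))).hasFDerivAt.comp (t, res q)
    ((HasFDerivAt.prodMap (t, res q) (hasFDerivAt_id (𝕜 := ℝ) t) hF0))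
  exact congrArg (fun T : (ℝ × Jet n (k+k+1)) →L[ℝ] ℝ => T (1, shft q)) hpull.fderiv

/-- the paper's relation (8).
For every function `g(t,q₀,…,q_{2k},p⁰)` on the intermediate space `P₁`,
`K₀·g = ⟨[L], (∂g/∂p⁰)∘F₀⟩ + D_t(g∘F₀)` identically as functions of
`(t,q₀,…,q_{2k+2})` (the left-hand side not depending on the top variable). -/
theorem K0_eq_EL_pairing_add_Dt_pullback
    (n k : ℕ) (hn : 1 ≤ n)
    (L : Jet n (k+1) → ℝ) (hL : ContDiff ℝ (⊤ : ℕ∞) L)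
    (g : ℝ × (Jet n (k+k) × Vec n) → ℝ) (hg : ContDiff ℝ (⊤ : ℕ∞) g) :
    ∀ (t : ℝ) (q : Jet n (k+k+2)),
      K0 L g (t, res q) =
        dot (EL L q) (gradMom g (t, F0 L (res q))) +
          Dt (pullF0 L g) (t, q) := by
  intro t q
  rw [EL_eq_gradSlot_sub_Dt0_mom hL, dot_gradMom, Dt_pullF0 hL (hg.differentiable (by simp)),
    ← map_add, K0]
  congr 1
  simp
  rfl

end
end

section
/- For the curvature Lagrangian L(x₀,x₁,x₂) = α√δ₂/δ₁, the Euler–Lagrange expression contracted with the velocity vanishes identically: ⟨[L], x₁⟩ = 0 for all (x₀,x₁,x₂,x₃,x₄) with δ₁ > 0 and δ₂ > 0. Consequently, for every smooth ε : ℝ → ℝ, the reparametrization δx = ε(t) x₁ is a Noether gauge transformation of L with identically vanishing conserved quantity: ⟨[L], ε(t)x₁⟩ + D_t 0 = 0. -/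
open scoped BigOperators Matrix

noncomputable section

/-- `V d` is `ℝ^d`. -/
abbrev V (d : ℕ) := Fin d → ℝ

variable {d : ℕ}

/-- The bilinear form determined by the symmetric matrix `B`:
`(u v) = B(u,v) = uᵀ B v`. -/
def bf (B : Matrix (Fin d) (Fin d) ℝ) (u v : V d) : ℝ := u ⬝ᵥ B *ᵥ v

/-- The Gram determinant of a family of vectors with respect to `B`. -/
def gram (B : Matrix (Fin d) (Fin d) ℝ) {m : ℕ} (x : Fin m → V d) : ℝ :=
  (Matrix.of fun i j => bf B (x i) (x j)).det

/-- `δ₁ = (x₁ x₁)` as a `1×1` Gram determinant. -/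
def d1 (B : Matrix (Fin d) (Fin d) ℝ) (x1 : V d) : ℝ := gram B ![x1]

/-- `δ₂`, the Gram determinant of `x₁, x₂`. -/
def d2 (B : Matrix (Fin d) (Fin d) ℝ) (x1 x2 : V d) : ℝ := gram B ![x1, x2]

/-- `δ₃`, the Gram determinant of `x₁, x₂, x₃`. -/
def d3 (B : Matrix (Fin d) (Fin d) ℝ) (x1 x2 x3 : V d) : ℝ := gram B ![x1, x2, x3]

/-- The orthogonalized vector `ξ₂ = x₂ − ((x₂ ξ₁)/(ξ₁ ξ₁)) ξ₁` (with `ξ₁ = x₁`). -/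
def xi2 (B : Matrix (Fin d) (Fin d) ℝ) (x1 x2 : V d) : V d :=
  x2 - (bf B x2 x1 / bf B x1 x1) • x1

/-- The orthogonalized vector
`ξ₃ = x₃ − ((x₃ ξ₂)/(ξ₂ ξ₂)) ξ₂ − ((x₃ ξ₁)/(ξ₁ ξ₁)) ξ₁`. -/
def xi3 (B : Matrix (Fin d) (Fin d) ℝ) (x1 x2 x3 : V d) : V d :=
  x3 - (bf B x3 (xi2 B x1 x2) / bf B (xi2 B x1 x2) (xi2 B x1 x2)) • xi2 B x1 x2
     - (bf B x3 x1 / bf B x1 x1) • x1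

/-- The curvature Lagrangian `L(x₀,x₁,x₂) = α √δ₂ / δ₁` of the relativistic
particle (independent of `x₀`). -/
def Lc (B : Matrix (Fin d) (Fin d) ℝ) (α : ℝ) (x : V d × V d × V d) : ℝ :=
  α * Real.sqrt (d2 B x.2.1 x.2.2) / d1 B x.2.1

/-- The Ostrogradskii momentum `p̂¹`, identified with a vector via `B`:
the (for nondegenerate symmetric `B`, unique) vector with
`B(p̂¹,v) = (∂L/∂x₂)[v]` for all `v`. -/
def p1h (B : Matrix (Fin d) (Fin d) ℝ) (α : ℝ) (x0 x1 x2 : V d) : V d :=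
  B⁻¹ *ᵥ fun a => fderiv ℝ (Lc B α) (x0, x1, x2) (0, 0, Pi.single a 1)

/-- The Ostrogradskii momentum `p̂⁰`, identified with a vector via `B`:
the vector with `B(p̂⁰,v) = (∂L/∂x₁)[v] − (D_t B(p̂¹,·))[v]` for all `v`. -/
def p0h (B : Matrix (Fin d) (Fin d) ℝ) (α : ℝ) (x0 x1 x2 x3 : V d) : V d :=
  B⁻¹ *ᵥ fun a =>
    fderiv ℝ (Lc B α) (x0, x1, x2) (0, Pi.single a 1, 0) -
      fderiv ℝ (fun y : V d × V d × V d =>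
          bf B (p1h B α y.1 y.2.1 y.2.2) (Pi.single a 1))
        (x0, x1, x2) (x1, x2, x3)

/-- The Euler–Lagrange expression `[L] = ∂L/∂x₀ − D_t(B(p̂⁰,·))` as a covector,
evaluated on the vector `v`. -/
def ELc (B : Matrix (Fin d) (Fin d) ℝ) (α : ℝ) (x0 x1 x2 x3 x4 : V d) (v : V d) : ℝ :=
  fderiv ℝ (Lc B α) (x0, x1, x2) (v, 0, 0) -
    fderiv ℝ (fun y : V d × V d × V d × V d =>
        bf B (p0h B α y.1 y.2.1 y.2.2.1 y.2.2.2) v)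
      (x0, x1, x2, x3) (x1, x2, x3, x4)

/-- The formal total time derivative of a time-dependent function
`f(t,x₀,x₁,x₂,x₃)`, a function of `(t,x₀,…,x₄)`. -/
def DtT (f : ℝ × (V d × V d × V d × V d) → ℝ)
    (t : ℝ) (x0 x1 x2 x3 x4 : V d) : ℝ :=
  fderiv ℝ f (t, (x0, x1, x2, x3)) (1, (x1, x2, x3, x4))

open Topology

/-- The Ostrogradskii momentum `p⁰` of a second-order Lagrangian `L`, as a covector. -/
def momentumZero {E : Type*} [NormedAddCommGroup E] [NormedSpace ℝ E] (L : E × E × E → ℝ)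
    (z : E × E × E × E) : E →L[ℝ] ℝ :=
  (fderiv ℝ L (z.1, z.2.1, z.2.2.1)).comp
      ((ContinuousLinearMap.inr ℝ E (E × E)).comp (ContinuousLinearMap.inl ℝ E E)) -
    (fderiv ℝ (fderiv ℝ L) (z.1, z.2.1, z.2.2.1) z.2).comp
      ((ContinuousLinearMap.inr ℝ E (E × E)).comp (ContinuousLinearMap.inr ℝ E E))

section Ostrogradskii

variable {E : Type*} [NormedAddCommGroup E] [NormedSpace ℝ E] {L : E × E × E → ℝ}

theorem momentumZero_apply (z : E × E × E × E) (v : E) :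
    momentumZero L z v = fderiv ℝ L (z.1, z.2.1, z.2.2.1) (0, v, 0) -
      fderiv ℝ (fderiv ℝ L) (z.1, z.2.1, z.2.2.1) z.2 (0, 0, v) := by
  simp [momentumZero]

theorem differentiableAt_momentumZero {z : E × E × E × E}
    (hL : ContDiffAt ℝ 3 L (z.1, z.2.1, z.2.2.1)) :
    DifferentiableAt ℝ (momentumZero L) z := by
  have hG : ContDiffAt ℝ 2 (fderiv ℝ L) (z.1, z.2.1, z.2.2.1) :=
    hL.fderiv_right (by norm_num)
  have hH : ContDiffAt ℝ 1 (fderiv ℝ (fderiv ℝ L)) (z.1, z.2.1, z.2.2.1) :=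
    hG.fderiv_right (by norm_num)
  have hG' : DifferentiableAt ℝ
      (fun z : E × E × E × E => fderiv ℝ L (z.1, z.2.1, z.2.2.1)) z :=
    (hG.differentiableAt (by norm_num)).comp z
      (f := fun z : E × E × E × E => (z.1, z.2.1, z.2.2.1)) (by fun_prop)
  have hH' : DifferentiableAt ℝ
      (fun z : E × E × E × E => fderiv ℝ (fderiv ℝ L) (z.1, z.2.1, z.2.2.1)) z :=
    (hH.differentiableAt (by norm_num)).comp z
      (f := fun z : E × E × E × E => (z.1, z.2.1, z.2.2.1)) (by fun_prop)
  unfold momentumZero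
  fun_prop

/-- If a second-order Lagrangian satisfies the Zermelo conditions on an open set, then the total
time derivative of the momentum `p⁰` agrees with `∂L/∂x₀` on the velocity. -/
theorem fderiv_momentumZero_apply_velocity {U : Set (E × E × E)} (hU : IsOpen U)
    (hL : ∀ y ∈ U, ContDiffAt ℝ 3 L y)
    (hZ₁ : ∀ y ∈ U, fderiv ℝ L y (0, 0, y.2.1) = 0)
    (hZ₂ : ∀ y ∈ U, fderiv ℝ L y (0, y.2.1, (2 : ℝ) • y.2.2) = L y)
    {x0 x1 x2 : E} (x3 x4 : E) (hx : (x0, x1, x2) ∈ U) :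
    fderiv ℝ (momentumZero L) (x0, x1, x2, x3) (x1, x2, x3, x4) x1 =
      fderiv ℝ L (x0, x1, x2) (x1, 0, 0) := by
  have hG : ∀ y ∈ U, DifferentiableAt ℝ (fderiv ℝ L) y := fun y hy =>
    ((hL y hy).fderiv_right (m := 2) (by norm_num)).differentiableAt (by norm_num)
  have hdiff : ∀ y ∈ U, ∀ w : E × E × E,
      fderiv ℝ (fderiv ℝ L) y w (0, 0, y.2.1) + fderiv ℝ L y (0, 0, w.2.1) = 0 := by
    intro y hy w
    have hinner : HasFDerivAt (fun y : E × E × E => ((0 : E), (0 : E), y.2.1))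
        (((ContinuousLinearMap.inr ℝ E (E × E)).comp (ContinuousLinearMap.inr ℝ E E)).comp
          ((ContinuousLinearMap.fst ℝ E E).comp (ContinuousLinearMap.snd ℝ E (E × E)))) y :=
      ContinuousLinearMap.hasFDerivAt (((ContinuousLinearMap.inr ℝ E (E × E)).comp
        (ContinuousLinearMap.inr ℝ E E)).comp
          ((ContinuousLinearMap.fst ℝ E E).comp (ContinuousLinearMap.snd ℝ E (E × E))))
    have h := (hG y hy).hasFDerivAt.clm_apply hinner
    have h0 : HasFDerivAt (fun y : E × E × E => fderiv ℝ L y (0, 0, y.2.1))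
        (0 : E × E × E →L[ℝ] ℝ) y :=
      (hasFDerivAt_const (0 : ℝ) y).congr_of_eventuallyEq
        (Filter.mem_of_superset (hU.mem_nhds hy) hZ₁)
    have := DFunLike.congr_fun (h.unique h0) w
    simpa [add_comm] using this
  set z : E × E × E × E := (x0, x1, x2, x3) with hz
  have hproj : HasFDerivAt (fun z : E × E × E × E => (z.1, z.2.1, z.2.2.1))
      ((ContinuousLinearMap.fst ℝ E (E × E × E)).prod
        (((ContinuousLinearMap.fst ℝ E (E × E)).prod
          ((ContinuousLinearMap.fst ℝ E E).comp (ContinuousLinearMap.snd ℝ E (E × E)))).comp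
            (ContinuousLinearMap.snd ℝ E (E × E × E)))) z :=
    ContinuousLinearMap.hasFDerivAt ((ContinuousLinearMap.fst ℝ E (E × E × E)).prod
        (((ContinuousLinearMap.fst ℝ E (E × E)).prod
          ((ContinuousLinearMap.fst ℝ E E).comp (ContinuousLinearMap.snd ℝ E (E × E)))).comp
            (ContinuousLinearMap.snd ℝ E (E × E × E))))
  have hvel : HasFDerivAt (fun z : E × E × E × E => z.2.1)
      ((ContinuousLinearMap.fst ℝ E (E × E)).comp (ContinuousLinearMap.snd ℝ E (E × E × E))) z :=
    ContinuousLinearMap.hasFDerivAt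
      ((ContinuousLinearMap.fst ℝ E (E × E)).comp (ContinuousLinearMap.snd ℝ E (E × E × E)))
  have hacc : HasFDerivAt (fun z : E × E × E × E => ((0 : E), (0 : E), z.2.2.1))
      (((ContinuousLinearMap.inr ℝ E (E × E)).comp (ContinuousLinearMap.inr ℝ E E)).comp
        ((ContinuousLinearMap.fst ℝ E E).comp ((ContinuousLinearMap.snd ℝ E (E × E)).comp
          (ContinuousLinearMap.snd ℝ E (E × E × E))))) z :=
    ContinuousLinearMap.hasFDerivAt
      (((ContinuousLinearMap.inr ℝ E (E × E)).comp (ContinuousLinearMap.inr ℝ E E)).comp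
        ((ContinuousLinearMap.fst ℝ E E).comp ((ContinuousLinearMap.snd ℝ E (E × E)).comp
          (ContinuousLinearMap.snd ℝ E (E × E × E)))))
  have hlhs := (differentiableAt_momentumZero (z := z) (hL _ hx)).hasFDerivAt.clm_apply hvel
  have hrhs := (((hL _ hx).differentiableAt (by norm_num)).hasFDerivAt.comp z hproj).sub
    (((hG _ hx).hasFDerivAt.comp z hproj).clm_apply hacc)
  have henergy : (fun z : E × E × E × E => momentumZero L z z.2.1) =ᶠ[𝓝 z]
      (fun z => L (z.1, z.2.1, z.2.2.1) -
        fderiv ℝ L (z.1, z.2.1, z.2.2.1) (0, 0, z.2.2.1)) := by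
    have hmem : ∀ᶠ z in 𝓝 z, (z.1, z.2.1, z.2.2.1) ∈ U :=
      hproj.continuousAt.eventually (hU.mem_nhds hx)
    filter_upwards [hmem] with u hu
    have h1 := hdiff _ hu u.2
    have h2 := hZ₂ _ hu
    have hsplit : ((0 : E), u.2.1, (2 : ℝ) • u.2.2.1) =
        (0, u.2.1, 0) + (2 : ℝ) • ((0 : E), (0 : E), u.2.2.1) := by simp
    simp only [hsplit, map_add, map_smul, smul_eq_mul] at h2
    rw [momentumZero_apply]
    simp only at h1 h2
    linarith
  have key := DFunLike.congr_fun (hlhs.unique (hrhs.congr_of_eventuallyEq henergy))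
    (x1, x2, x3, x4)
  have hsplit : (x1, x2, x3) = (x1, 0, 0) + ((0, x2, 0) + ((0 : E), (0 : E), x3)) := by simp
  simp [hz, momentumZero_apply] at key
  have h3 : fderiv ℝ L (x0, x1, x2) (x1, x2, x3) = fderiv ℝ L (x0, x1, x2) (x1, 0, 0) +
    (fderiv ℝ L (x0, x1, x2) (0, x2, 0) + fderiv ℝ L (x0, x1, x2) (0, 0, x3)) := by
    rw [← map_add, ← map_add, ← hsplit]
  linarith

end Ostrogradskii

theorem bf_inv_mulVec {B : Matrix (Fin d) (Fin d) ℝ} (hBsymm : B.IsSymm) (hBnd : IsUnit B.det)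
    (w v : V d) : bf B (B⁻¹ *ᵥ w) v = w ⬝ᵥ v := by
  have hsymm : (B⁻¹)ᵀ = B⁻¹ := by rw [Matrix.transpose_nonsing_inv, hBsymm.eq]
  rw [bf, ← Matrix.vecMul_transpose, hsymm, ← Matrix.dotProduct_mulVec, Matrix.mulVec_mulVec,
    Matrix.nonsing_inv_mul _ hBnd, Matrix.one_mulVec]

theorem ContinuousLinearMap.dotProduct_single (f : V d →L[ℝ] ℝ) (v : V d) :
    (fun a => f (Pi.single a 1)) ⬝ᵥ v = f v := by
  conv_rhs => rw [pi_eq_sum_univ' v]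
  simp [dotProduct, mul_comm]

theorem bf_p1h {B : Matrix (Fin d) (Fin d) ℝ} (hBsymm : B.IsSymm) (hBnd : IsUnit B.det) (α : ℝ)
    (x0 x1 x2 v : V d) :
    bf B (p1h B α x0 x1 x2) v = fderiv ℝ (Lc B α) (x0, x1, x2) (0, 0, v) := by
  rw [p1h, bf_inv_mulVec hBsymm hBnd]
  exact ((fderiv ℝ (Lc B α) (x0, x1, x2)).comp ((ContinuousLinearMap.inr ℝ _ _).comp
    (ContinuousLinearMap.inr ℝ _ _))).dotProduct_single v

theorem bf_p0h {B : Matrix (Fin d) (Fin d) ℝ} (hBsymm : B.IsSymm) (hBnd : IsUnit B.det) (α : ℝ)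
    (z : V d × V d × V d × V d)
    (hL : DifferentiableAt ℝ (fderiv ℝ (Lc B α)) (z.1, z.2.1, z.2.2.1)) (v : V d) :
    bf B (p0h B α z.1 z.2.1 z.2.2.1 z.2.2.2) v = momentumZero (Lc B α) z v := by
  rw [p0h, bf_inv_mulVec hBsymm hBnd, ← (momentumZero (Lc B α) z).dotProduct_single v]
  congr 1
  funext a
  rw [momentumZero_apply]
  simp only [bf_p1h hBsymm hBnd]
  rw [fderiv_clm_apply hL (differentiableAt_const _)]
  simp

theorem ELc_eq {B : Matrix (Fin d) (Fin d) ℝ} (hBsymm : B.IsSymm) (hBnd : IsUnit B.det) (α : ℝ)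
    {x0 x1 x2 : V d} (x3 x4 v : V d)
    (hL : ContDiffAt ℝ 3 (Lc B α) (x0, x1, x2)) :
    ELc B α x0 x1 x2 x3 x4 v = fderiv ℝ (Lc B α) (x0, x1, x2) (v, 0, 0) -
      fderiv ℝ (momentumZero (Lc B α)) (x0, x1, x2, x3) (x1, x2, x3, x4) v := by
  have hproj : ContinuousAt (fun z : V d × V d × V d × V d => (z.1, z.2.1, z.2.2.1))
      (x0, x1, x2, x3) := by fun_prop
  have hev : (fun z : V d × V d × V d × V d => bf B (p0h B α z.1 z.2.1 z.2.2.1 z.2.2.2) v)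
      =ᶠ[𝓝 (x0, x1, x2, x3)] fun z => momentumZero (Lc B α) z v := by
    filter_upwards [hproj.eventually (hL.eventually (by simp))] with z hz
    exact bf_p0h hBsymm hBnd α z
      ((hz.fderiv_right (m := 2) (by norm_num)).differentiableAt (by norm_num)) v
  rw [ELc, hev.fderiv_eq, fderiv_clm_apply
    (differentiableAt_momentumZero (z := (x0, x1, x2, x3)) hL) (differentiableAt_const _)]
  simp

theorem d1_eq (B : Matrix (Fin d) (Fin d) ℝ) (x1 : V d) : d1 B x1 = bf B x1 x1 := by
  simp [d1, gram]

theorem d2_eq (B : Matrix (Fin d) (Fin d) ℝ) (x1 x2 : V d) :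
    d2 B x1 x2 = bf B x1 x1 * bf B x2 x2 - bf B x1 x2 * bf B x2 x1 := by
  simp [d2, gram, Matrix.det_fin_two]

theorem ContDiff.bf {F : Type*} [NormedAddCommGroup F] [NormedSpace ℝ F] {n : WithTop ℕ∞}
    (B : Matrix (Fin d) (Fin d) ℝ) {f g : F → V d} (hf : ContDiff ℝ n f) (hg : ContDiff ℝ n g) :
    ContDiff ℝ n (fun y => bf B (f y) (g y)) := by
  rw [contDiff_pi] at hf hg
  unfold _root_.bf dotProduct Matrix.mulVec dotProduct
  exact ContDiff.sum fun i _ => (hf i).mul (ContDiff.sum fun j _ => contDiff_const.mul (hg j))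

theorem contDiff_d1 {n : WithTop ℕ∞} (B : Matrix (Fin d) (Fin d) ℝ) :
    ContDiff ℝ n (fun y : V d × V d × V d => d1 B y.2.1) := by
  simp only [d1_eq]
  exact ContDiff.bf B (by fun_prop) (by fun_prop)

theorem contDiff_d2 {n : WithTop ℕ∞} (B : Matrix (Fin d) (Fin d) ℝ) :
    ContDiff ℝ n (fun y : V d × V d × V d => d2 B y.2.1 y.2.2) := by
  simp only [d2_eq]
  exact ((ContDiff.bf B (by fun_prop) (by fun_prop)).mul
    (ContDiff.bf B (by fun_prop) (by fun_prop))).sub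
    ((ContDiff.bf B (by fun_prop) (by fun_prop)).mul (ContDiff.bf B (by fun_prop) (by fun_prop)))

theorem contDiffAt_Lc {n : WithTop ℕ∞} (B : Matrix (Fin d) (Fin d) ℝ) (α : ℝ)
    {y : V d × V d × V d} (h1 : 0 < d1 B y.2.1) (h2 : 0 < d2 B y.2.1 y.2.2) :
    ContDiffAt ℝ n (Lc B α) y :=
  (contDiffAt_const.mul ((contDiff_d2 B).contDiffAt.sqrt h2.ne')).div
    (contDiff_d1 B).contDiffAt h1.ne'

theorem bf_add_left (B : Matrix (Fin d) (Fin d) ℝ) (u v w : V d) :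
    bf B (u + v) w = bf B u w + bf B v w := by simp [bf]

theorem bf_add_right (B : Matrix (Fin d) (Fin d) ℝ) (u v w : V d) :
    bf B u (v + w) = bf B u v + bf B u w := by simp [bf, Matrix.mulVec_add]

theorem bf_smul_left (B : Matrix (Fin d) (Fin d) ℝ) (c : ℝ) (u v : V d) :
    bf B (c • u) v = c * bf B u v := by simp [bf]

theorem bf_smul_right (B : Matrix (Fin d) (Fin d) ℝ) (c : ℝ) (u v : V d) :
    bf B u (c • v) = c * bf B u v := by simp [bf, Matrix.mulVec_smul]

theorem Lc_add_smul_velocity (B : Matrix (Fin d) (Fin d) ℝ) (α s : ℝ) (x0 x1 x2 : V d) :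
    Lc B α (x0, x1, x2 + s • x1) = Lc B α (x0, x1, x2) := by
  simp only [Lc, d2_eq, bf_add_left, bf_add_right, bf_smul_left, bf_smul_right]
  congr 3
  ring

theorem Lc_rescale (B : Matrix (Fin d) (Fin d) ℝ) (α : ℝ) {s : ℝ} (hs : 0 < s)
    (x0 x1 x2 : V d) :
    Lc B α (x0, s • x1, s ^ 2 • x2) = s * Lc B α (x0, x1, x2) := by
  have h2 : d2 B (s • x1) (s ^ 2 • x2) = (s ^ 3) ^ 2 * d2 B x1 x2 := by
    simp only [d2_eq, bf_smul_left, bf_smul_right]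
    ring
  have h1 : d1 B (s • x1) = s ^ 2 * d1 B x1 := by
    simp only [d1_eq, bf_smul_left, bf_smul_right]
    ring
  simp only [Lc, h1, h2]
  rw [Real.sqrt_mul (by positivity), Real.sqrt_sq (by positivity)]
  rcases eq_or_ne (d1 B x1) 0 with h | h
  · simp [h]
  · field_simp

theorem fderiv_Lc_velocity (B : Matrix (Fin d) (Fin d) ℝ) (α : ℝ) {y : V d × V d × V d}
    (hL : DifferentiableAt ℝ (Lc B α) y) : fderiv ℝ (Lc B α) y (0, 0, y.2.1) = 0 := by
  have hc : HasDerivAt (fun s : ℝ => (y.1, y.2.1, y.2.2 + s • y.2.1)) (0, 0, y.2.1) 0 := by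
    refine (hasDerivAt_const _ _).prodMk ((hasDerivAt_const _ _).prodMk ?_)
    simpa using ((hasDerivAt_id (0 : ℝ)).smul_const y.2.1).const_add y.2.2
  have h := HasFDerivAt.comp_hasDerivAt_of_eq 0 hL.hasFDerivAt hc (by simp)
  simp only [Function.comp_def, Lc_add_smul_velocity] at h
  exact h.unique (hasDerivAt_const _ _)

theorem fderiv_Lc_rescale (B : Matrix (Fin d) (Fin d) ℝ) (α : ℝ) {y : V d × V d × V d}
    (hL : DifferentiableAt ℝ (Lc B α) y) :
    fderiv ℝ (Lc B α) y (0, y.2.1, (2 : ℝ) • y.2.2) = Lc B α y := by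
  have hc : HasDerivAt (fun s : ℝ => (y.1, s • y.2.1, s ^ 2 • y.2.2))
      (0, y.2.1, (2 : ℝ) • y.2.2) 1 := by
    refine (hasDerivAt_const _ _).prodMk (HasDerivAt.prodMk ?_ ?_)
    · simpa using (hasDerivAt_id (1 : ℝ)).smul_const y.2.1
    · simpa using (hasDerivAt_pow 2 (1 : ℝ)).smul_const y.2.2
  have h := HasFDerivAt.comp_hasDerivAt_of_eq 1 hL.hasFDerivAt hc (by simp)
  have hlin : HasDerivAt (fun s : ℝ => s * Lc B α y) (Lc B α y) 1 := by
    simpa using (hasDerivAt_id (1 : ℝ)).mul_const (Lc B α y)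
  refine h.unique (hlin.congr_of_eventuallyEq ?_)
  filter_upwards [lt_mem_nhds (zero_lt_one' ℝ)] with s hs
  exact Lc_rescale B α hs _ _ _

theorem ELc_smul_velocity {B : Matrix (Fin d) (Fin d) ℝ} (hBsymm : B.IsSymm)
    (hBnd : IsUnit B.det) (α c : ℝ) {x0 x1 x2 : V d} (x3 x4 : V d)
    (h1 : 0 < d1 B x1) (h2 : 0 < d2 B x1 x2) :
    ELc B α x0 x1 x2 x3 x4 (c • x1) = 0 := by
  set U : Set (V d × V d × V d) := {y | 0 < d1 B y.2.1 ∧ 0 < d2 B y.2.1 y.2.2} with hUdef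
  have hU : IsOpen U :=
    (isOpen_lt continuous_const (contDiff_d1 (n := 0) B).continuous).inter
      (isOpen_lt continuous_const (contDiff_d2 (n := 0) B).continuous)
  have hL : ∀ y ∈ U, ContDiffAt ℝ 3 (Lc B α) y := fun y hy => contDiffAt_Lc B α hy.1 hy.2
  have hd : ∀ y ∈ U, DifferentiableAt ℝ (Lc B α) y := fun y hy =>
    (hL y hy).differentiableAt (by norm_num)
  have hx : (x0, x1, x2) ∈ U := ⟨h1, h2⟩
  have hsmul : (c • x1, (0 : V d), (0 : V d)) = c • (x1, 0, 0) := by simp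
  rw [ELc_eq hBsymm hBnd α x3 x4 _ (hL _ hx), hsmul, map_smul, map_smul,
    fderiv_momentumZero_apply_velocity hU hL (fun y hy => fderiv_Lc_velocity B α (hd y hy))
      (fun y hy => fderiv_Lc_rescale B α (hd y hy)) x3 x4 hx, sub_self]

/-- reparametrization invariance.
For the curvature Lagrangian, `⟨[L], x₁⟩ = 0` identically where `δ₁ > 0` and
`δ₂ > 0`; consequently, for every smooth `ε : ℝ → ℝ`, the reparametrization
`δx = ε(t) x₁` is a Noether gauge transformation with identically vanishing
conserved quantity: `⟨[L], ε(t)x₁⟩ + D_t 0 = 0`. -/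
theorem curvature_reparametrization_gauge
    (d : ℕ) (hd : 3 ≤ d) (B : Matrix (Fin d) (Fin d) ℝ)
    (hBsymm : B.IsSymm) (hBnd : IsUnit B.det)
    (α : ℝ) (hα : α ≠ 0) :
    (∀ x0 x1 x2 x3 x4 : V d, 0 < d1 B x1 → 0 < d2 B x1 x2 →
      ELc B α x0 x1 x2 x3 x4 x1 = 0) ∧
    ∀ ε : ℝ → ℝ, ContDiff ℝ (⊤ : ℕ∞) ε →
      ∀ (t : ℝ) (x0 x1 x2 x3 x4 : V d), 0 < d1 B x1 → 0 < d2 B x1 x2 →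
        ELc B α x0 x1 x2 x3 x4 (ε t • x1) +
          DtT (fun _ : ℝ × (V d × V d × V d × V d) => (0 : ℝ)) t x0 x1 x2 x3 x4
          = 0 := by
  refine ⟨fun x0 x1 x2 x3 x4 h1 h2 => ?_, fun ε _ t x0 x1 x2 x3 x4 h1 h2 => ?_⟩
  · simpa using ELc_smul_velocity hBsymm hBnd α 1 x3 x4 h1 h2
  · rw [ELc_smul_velocity hBsymm hBnd α (ε t) x3 x4 h1 h2]
    simp [DtT]

end
end
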